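/- The polynomial function f : ℝ² → ℝ given by f(x,y) = x·(x + 2(y+1)(y−2) − 1/2)·(x + (y−1)(y+2) − 1) has only nondegenerate critical points, and it has exactly ten critical points, of which exactly two are local minima, exactly six are saddles, and exactly two are local maxima. -/

import Mathlib

/-- A point `p = (x₀, y₀)` is a critical point of `f : ℝ → ℝ → ℝ` if both
partial derivatives of `f` vanish at `p`. -/
def IsCriticalPt (f : ℝ → ℝ → ℝ) (p : ℝ × ℝ) : Prop :=
  deriv (fun t => f t p.2) p.1 = 0 ∧ deriv (fun t => f p.1 t) p.2 = 0

/-- The Hessian determinant `f_xx(p) * f_yy(p) - f_xy(p)^2` of `f` at `p`. -/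
noncomputable def hessDet (f : ℝ → ℝ → ℝ) (p : ℝ × ℝ) : ℝ :=
  deriv (fun x => deriv (fun t => f t p.2) x) p.1 *
      deriv (fun y => deriv (fun t => f p.1 t) y) p.2 -
    (deriv (fun y => deriv (fun t => f t y) p.1) p.2) ^ 2

/-- `p` is a local minimum point of the function `(x, y) ↦ f x y`. -/
def IsLocMin (f : ℝ → ℝ → ℝ) (p : ℝ × ℝ) : Prop :=
  IsLocalMin (fun q : ℝ × ℝ => f q.1 q.2) p

/-- `p` is a local maximum point of the function `(x, y) ↦ f x y`. -/
def IsLocMax (f : ℝ → ℝ → ℝ) (p : ℝ × ℝ) : Prop :=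
  IsLocalMax (fun q : ℝ × ℝ => f q.1 q.2) p

/-- A saddle is a critical point that is neither a local minimum
nor a local maximum. -/
def IsSaddle (f : ℝ → ℝ → ℝ) (p : ℝ × ℝ) : Prop :=
  IsCriticalPt f p ∧ ¬ IsLocMin f p ∧ ¬ IsLocMax f p

/-- Realizing polynomial (J₁₀³, ten critical points, two maxima). -/
noncomputable def f10 : ℝ → ℝ → ℝ := fun x y => x * (x + 2 * (y + 1) * (y - 2) - 1 / 2) * (x + (y - 1) * (y + 2) - 1)

open Filter Topology

section QuadraticForm

variable {F : ℝ × ℝ → ℝ} {p : ℝ × ℝ} {U V W : ℝ × ℝ → ℝ}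

/-- If `F (p + h) - F p` is a quadratic form in `h` whose coefficients depend continuously on `h`,
and the form at `h = 0` is positive definite, then `p` is a local minimum. -/
theorem isLocalMin_of_quadratic (hU : Continuous U) (hV : Continuous V) (hW : Continuous W)
    (hF : ∀ h, F (p + h) - F p = h.1 ^ 2 * U h + 2 * (h.1 * h.2) * V h + h.2 ^ 2 * W h)
    (hpos : 0 < U 0) (hdet : 0 < U 0 * W 0 - V 0 ^ 2) : IsLocalMin F p := by
  have hU' : ∀ᶠ h in 𝓝 (0 : ℝ × ℝ), 0 < U h :=
    hU.continuousAt.eventually (lt_mem_nhds hpos)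
  have hdet' : ∀ᶠ h in 𝓝 (0 : ℝ × ℝ), 0 < U h * W h - V h ^ 2 :=
    ((hU.mul hW).sub (hV.pow 2)).continuousAt.eventually (lt_mem_nhds hdet)
  have hsub : Tendsto (fun q : ℝ × ℝ => q - p) (𝓝 p) (𝓝 0) := by
    have hc : Continuous (fun q : ℝ × ℝ => q - p) := by fun_prop
    simpa using hc.tendsto p
  filter_upwards [hsub.eventually hU', hsub.eventually hdet'] with q h₁ h₂
  have hq := hF (q - p)
  rw [add_sub_cancel] at hq
  generalize q - p = h at *
  have key : U h * (F q - F p) = (h.1 * U h + h.2 * V h) ^ 2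
      + h.2 ^ 2 * (U h * W h - V h ^ 2) := by rw [hq]; ring
  have : 0 ≤ U h * (F q - F p) := by rw [key]; positivity
  linarith [nonneg_of_mul_nonneg_right this h₁]

/-- At a local maximum the quadratic form of `isLocalMin_of_quadratic` is negative
semidefinite. -/
theorem quadratic_nonpos_of_isLocalMax (hU : Continuous U) (hV : Continuous V)
    (hW : Continuous W)
    (hF : ∀ h, F (p + h) - F p = h.1 ^ 2 * U h + 2 * (h.1 * h.2) * V h + h.2 ^ 2 * W h)
    (hmax : IsLocalMax F p) (a b : ℝ) :
    a ^ 2 * U 0 + 2 * (a * b) * V 0 + b ^ 2 * W 0 ≤ 0 := by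
  have hlim : Tendsto (fun t : ℝ => a ^ 2 * U (t * a, t * b) + 2 * (a * b) * V (t * a, t * b)
      + b ^ 2 * W (t * a, t * b)) (𝓝[≠] 0)
      (𝓝 (a ^ 2 * U 0 + 2 * (a * b) * V 0 + b ^ 2 * W 0)) := by
    have hc : Continuous (fun t : ℝ => a ^ 2 * U (t * a, t * b) + 2 * (a * b) * V (t * a, t * b)
      + b ^ 2 * W (t * a, t * b)) := by fun_prop
    have := hc.tendsto 0
    simp only [zero_mul, Prod.mk_zero_zero] at this
    exact this.mono_left nhdsWithin_le_nhds
  refine le_of_tendsto hlim ?_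
  have hline : Tendsto (fun t : ℝ => p + (t * a, t * b)) (𝓝 0) (𝓝 p) := by
    have hc : Continuous (fun t : ℝ => p + (t * a, t * b)) := by fun_prop
    simpa only [zero_mul, Prod.mk_zero_zero, add_zero] using hc.tendsto 0
  filter_upwards [nhdsWithin_le_nhds (hline.eventually hmax), self_mem_nhdsWithin] with t ht ht0
  have h := hF (t * a, t * b)
  have ht2 : 0 < t ^ 2 := by
    have : t ≠ 0 := ht0
    positivity
  refine nonpos_of_mul_nonpos_right ?_ ht2
  calc _ = F (p + (t * a, t * b)) - F p := by rw [h]; ring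
    _ ≤ 0 := by linarith

end QuadraticForm

theorem nonneg_det_of_quadratic_nonpos {u v w : ℝ}
    (h : ∀ a b : ℝ, a ^ 2 * u + 2 * (a * b) * v + b ^ 2 * w ≤ 0) : 0 ≤ u * w - v ^ 2 := by
  have hu : u ≤ 0 := by simpa using h 1 0
  rcases hu.lt_or_eq with hu | rfl
  · nlinarith [h v (-u)]
  · linarith [h ((1 - w) / 2) v]

/-- The second partial derivative of `f10` in `x`; `f10xy` and `f10yy` are the other two. -/
noncomputable def f10xx (x y : ℝ) : ℝ := 6 * x + 2 * (3 * y ^ 2 - y - 15 / 2)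

noncomputable def f10xy (x y : ℝ) : ℝ := 2 * (6 * y - 1) * x + (8 * y ^ 3 - 25 * y + 3 / 2)

def f10yy (x y : ℝ) : ℝ := x * (6 * x + (24 * y ^ 2 - 25))

theorem deriv_quartic (c₀ c₁ c₂ c₃ c₄ x : ℝ) :
    deriv (fun t : ℝ => c₀ + c₁ * t + c₂ * t ^ 2 + c₃ * t ^ 3 + c₄ * t ^ 4) x =
      c₁ + 2 * c₂ * x + 3 * c₃ * x ^ 2 + 4 * c₄ * x ^ 3 := by
  have h (n : ℕ) (c : ℝ) := (hasDerivAt_pow n x).const_mul c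
  have := (((((hasDerivAt_id x).const_mul c₁).const_add c₀).add (h 2 c₂)).add (h 3 c₃)).add
    (h 4 c₄)
  refine (this.deriv.trans ?_)
  norm_num
  ring

theorem deriv_f10_fst (x y : ℝ) : deriv (fun t => f10 t y) x =
    3 * x ^ 2 + 2 * (3 * y ^ 2 - y - 15 / 2) * x
      + (2 * y ^ 2 - 2 * y - 9 / 2) * (y ^ 2 + y - 3) := by
  convert deriv_quartic 0 ((2 * y ^ 2 - 2 * y - 9 / 2) * (y ^ 2 + y - 3))
    (3 * y ^ 2 - y - 15 / 2) 1 0 x using 1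
  · congr 1; funext t; simp only [f10]; ring
  · ring

theorem deriv_f10_snd (x y : ℝ) : deriv (fun t => f10 x t) y =
    x * ((6 * y - 1) * x + (8 * y ^ 3 - 25 * y + 3 / 2)) := by
  convert deriv_quartic (x ^ 3 - 15 / 2 * x ^ 2 + 27 / 2 * x) (-x ^ 2 + 3 / 2 * x)
    (3 * x ^ 2 - 25 / 2 * x) 0 (2 * x) y using 1
  · congr 1; funext t; simp only [f10]; ring
  · ring

theorem hessDet_f10 (x y : ℝ) :
    hessDet f10 (x, y) = f10xx x y * f10yy x y - f10xy x y ^ 2 := by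
  simp only [hessDet, deriv_f10_fst, deriv_f10_snd]
  congr 2
  · convert deriv_quartic ((2 * y ^ 2 - 2 * y - 9 / 2) * (y ^ 2 + y - 3))
      (2 * (3 * y ^ 2 - y - 15 / 2)) 3 0 0 x using 1
    · congr 1; funext t; ring
    · simp only [f10xx]; ring
  · convert deriv_quartic (-x ^ 2 + 3 / 2 * x) (6 * x ^ 2 - 25 * x) 0 (8 * x) 0 y using 1
    · congr 1; funext t; ring
    · simp only [f10yy]; ring
  · convert deriv_quartic (3 * x ^ 2 - 15 * x + 27 / 2) (-2 * x + 3 / 2) (6 * x - 25 / 2) 0 2 y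
      using 1
    · congr 1; funext t; ring
    · simp only [f10xy]; ring

theorem isCriticalPt_f10_iff (x y : ℝ) : IsCriticalPt f10 (x, y) ↔
    3 * x ^ 2 + 2 * (3 * y ^ 2 - y - 15 / 2) * x
      + (2 * y ^ 2 - 2 * y - 9 / 2) * (y ^ 2 + y - 3) = 0 ∧
    x * ((6 * y - 1) * x + (8 * y ^ 3 - 25 * y + 3 / 2)) = 0 := by
  simp only [IsCriticalPt, deriv_f10_fst, deriv_f10_snd]

/-- The Taylor expansion of `f10` at a critical point, with the remainder absorbed into the
coefficients of the quadratic form. -/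
theorem exists_quadratic_f10 {x y : ℝ} (hc : IsCriticalPt f10 (x, y)) :
    ∃ U V W : ℝ × ℝ → ℝ, Continuous U ∧ Continuous V ∧ Continuous W ∧
      (∀ h : ℝ × ℝ, (fun q : ℝ × ℝ => f10 q.1 q.2) ((x, y) + h)
          - (fun q : ℝ × ℝ => f10 q.1 q.2) (x, y) =
        h.1 ^ 2 * U h + 2 * (h.1 * h.2) * V h + h.2 ^ 2 * W h) ∧
      U 0 = f10xx x y / 2 ∧ V 0 = f10xy x y / 2 ∧ W 0 = f10yy x y / 2 := by
  obtain ⟨h₁, h₂⟩ := (isCriticalPt_f10_iff x y).1 hc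
  refine ⟨fun h => 3 * x + h.1 + (3 * (y + h.2) ^ 2 - (y + h.2) - 15 / 2),
    fun h => (2 * x * (6 * y - 1 + 3 * h.2) + (8 * y ^ 3 - 25 * y + 3 / 2)
      + h.2 * (12 * y ^ 2 - 25 / 2 + 8 * y * h.2 + 2 * h.2 ^ 2)) / 2,
    fun h => 3 * x ^ 2 + x * (12 * y ^ 2 - 25 / 2 + 8 * y * h.2 + 2 * h.2 ^ 2),
    by fun_prop, by fun_prop, by fun_prop, ?_, ?_, ?_, ?_⟩
  · rintro ⟨a, b⟩
    simp only [f10, Prod.mk_add_mk]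
    linear_combination a * h₁ + b * h₂
  · simp only [f10xx, Prod.fst_zero, Prod.snd_zero]; ring
  · simp only [f10xy, Prod.snd_zero]; ring
  · simp only [f10yy, Prod.snd_zero]; ring

section Classification

variable {x y : ℝ}

theorem hessDet_nonneg_of_isLocMax (hc : IsCriticalPt f10 (x, y)) (hm : IsLocMax f10 (x, y)) :
    f10xx x y ≤ 0 ∧ 0 ≤ hessDet f10 (x, y) := by
  obtain ⟨U, V, W, hU, hV, hW, hF, h₁, h₂, h₃⟩ := exists_quadratic_f10 hc
  have h := quadratic_nonpos_of_isLocalMax hU hV hW hF hm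
  have hdet := nonneg_det_of_quadratic_nonpos h
  have hu := h 1 0
  rw [h₁, h₂, h₃] at hdet
  rw [h₁] at hu
  rw [hessDet_f10]
  constructor <;> linarith

theorem hessDet_nonneg_of_isLocMin (hc : IsCriticalPt f10 (x, y)) (hm : IsLocMin f10 (x, y)) :
    0 ≤ f10xx x y ∧ 0 ≤ hessDet f10 (x, y) := by
  obtain ⟨U, V, W, hU, hV, hW, hF, h₁, h₂, h₃⟩ := exists_quadratic_f10 hc
  have h := quadratic_nonpos_of_isLocalMax hU.neg hV.neg hW.neg
    (F := fun q : ℝ × ℝ => -f10 q.1 q.2)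
    (fun h => by simp only [Pi.neg_apply]; linear_combination -hF h) (IsLocalMin.neg hm)
  have hdet := nonneg_det_of_quadratic_nonpos h
  have hu := h 1 0
  simp only [Pi.neg_apply, h₁, h₂, h₃] at hdet hu
  rw [hessDet_f10]
  constructor <;> linarith

theorem isLocMin_f10 (hc : IsCriticalPt f10 (x, y)) (hx : 0 < f10xx x y)
    (hd : 0 < hessDet f10 (x, y)) : IsLocMin f10 (x, y) := by
  obtain ⟨U, V, W, hU, hV, hW, hF, h₁, h₂, h₃⟩ := exists_quadratic_f10 hc
  rw [hessDet_f10] at hd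
  refine isLocalMin_of_quadratic hU hV hW hF ?_ ?_
  · rw [h₁]; linarith
  · rw [h₁, h₂, h₃]; linarith

theorem isLocMax_f10 (hc : IsCriticalPt f10 (x, y)) (hx : f10xx x y < 0)
    (hd : 0 < hessDet f10 (x, y)) : IsLocMax f10 (x, y) := by
  obtain ⟨U, V, W, hU, hV, hW, hF, h₁, h₂, h₃⟩ := exists_quadratic_f10 hc
  rw [hessDet_f10] at hd
  have : IsLocalMin (fun q : ℝ × ℝ => -f10 q.1 q.2) (x, y) := by
    refine isLocalMin_of_quadratic hU.neg hV.neg hW.neg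
      (fun h => by simp only [Pi.neg_apply]; linear_combination -hF h) ?_ ?_
    · simp only [Pi.neg_apply, h₁]; linarith
    · simp only [Pi.neg_apply, h₁, h₂, h₃]; linarith
  simpa [IsLocMax] using this.neg

end Classification

/-- A critical point of `f10` that is a minimum in the sense of the second derivative test. -/
def IsMinPt (p : ℝ × ℝ) : Prop :=
  IsCriticalPt f10 p ∧ 0 < f10xx p.1 p.2 ∧ 0 < hessDet f10 p

def IsMaxPt (p : ℝ × ℝ) : Prop :=
  IsCriticalPt f10 p ∧ f10xx p.1 p.2 < 0 ∧ 0 < hessDet f10 p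

def IsSaddlePt (p : ℝ × ℝ) : Prop :=
  IsCriticalPt f10 p ∧ hessDet f10 p < 0

section Types

variable {p : ℝ × ℝ}

theorem IsMinPt.types (h : IsMinPt p) :
    IsCriticalPt f10 p ∧ hessDet f10 p ≠ 0 ∧ IsLocMin f10 p ∧ ¬ IsLocMax f10 p :=
  ⟨h.1, h.2.2.ne', isLocMin_f10 h.1 h.2.1 h.2.2,
    fun hm => (hessDet_nonneg_of_isLocMax h.1 hm).1.not_gt h.2.1⟩

theorem IsMaxPt.types (h : IsMaxPt p) :
    IsCriticalPt f10 p ∧ hessDet f10 p ≠ 0 ∧ ¬ IsLocMin f10 p ∧ IsLocMax f10 p :=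
  ⟨h.1, h.2.2.ne', fun hm => (hessDet_nonneg_of_isLocMin h.1 hm).1.not_gt h.2.1,
    isLocMax_f10 h.1 h.2.1 h.2.2⟩

theorem IsSaddlePt.types (h : IsSaddlePt p) :
    IsCriticalPt f10 p ∧ hessDet f10 p ≠ 0 ∧ ¬ IsLocMin f10 p ∧ ¬ IsLocMax f10 p :=
  ⟨h.1, h.2.ne, fun hm => (hessDet_nonneg_of_isLocMin h.1 hm).2.not_gt h.2,
    fun hm => (hessDet_nonneg_of_isLocMax h.1 hm).2.not_gt h.2⟩

end Types

/-- The quartic whose roots are the `y`-coordinates of the extrema of `f10`. -/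
noncomputable def extremaQuartic (y : ℝ) : ℝ := -24 * y ^ 4 + 48 * y ^ 3 + 64 * y ^ 2 - 84 * y + 3 / 2

theorem exists_extremaQuartic_eq_zero {a b : ℝ} (hab : a ≤ b)
    (h : extremaQuartic a * extremaQuartic b < 0) :
    ∃ y, a < y ∧ y < b ∧ extremaQuartic y = 0 := by
  have hc : ContinuousOn extremaQuartic (Set.Icc a b) := by
    unfold extremaQuartic; fun_prop
  rcases mul_neg_iff.1 h with ⟨ha, hb⟩ | ⟨ha, hb⟩
  · obtain ⟨y, hy, h0⟩ := intermediate_value_Ioo' hab hc ⟨hb, ha⟩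
    exact ⟨y, hy.1, hy.2, h0⟩
  · obtain ⟨y, hy, h0⟩ := intermediate_value_Ioo hab hc ⟨ha, hb⟩
    exact ⟨y, hy.1, hy.2, h0⟩

open Polynomial in
theorem eq_of_extremaQuartic_eq_zero {r₁ r₂ r₃ r₄ y : ℝ} (h₁₂ : r₁ < r₂) (h₂₃ : r₂ < r₃)
    (h₃₄ : r₃ < r₄) (h₁ : extremaQuartic r₁ = 0) (h₂ : extremaQuartic r₂ = 0)
    (h₃ : extremaQuartic r₃ = 0) (h₄ : extremaQuartic r₄ = 0) (hy : extremaQuartic y = 0) :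
    y = r₁ ∨ y = r₂ ∨ y = r₃ ∨ y = r₄ := by
  by_contra! hne
  obtain ⟨n₁, n₂, n₃, n₄⟩ := hne
  let P : ℝ[X] := C (-24) * X ^ 4 + C 48 * X ^ 3 + C 64 * X ^ 2 + C (-84) * X + C (3 / 2)
  have heval (t : ℝ) : P.eval t = extremaQuartic t := by
    simp only [P, extremaQuartic, eval_add, eval_mul, eval_C, eval_pow, eval_X]; ring
  have hdeg : P.natDegree ≤ 4 := by
    simp only [P]; compute_degree
  have hcard : ({y, r₁, r₂, r₃, r₄} : Finset ℝ).card = 5 := by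
    have := h₁₂.trans h₂₃
    have := h₂₃.trans h₃₄
    have := h₁₂.trans (h₂₃.trans h₃₄)
    rw [Finset.card_insert_of_notMem, Finset.card_insert_of_notMem,
      Finset.card_insert_of_notMem, Finset.card_pair h₃₄.ne] <;>
      simp only [Finset.mem_insert, Finset.mem_singleton, not_or]
    · exact ⟨h₂₃.ne, by grind⟩
    · exact ⟨h₁₂.ne, by grind, by grind⟩
    · exact ⟨n₁, n₂, n₃, n₄⟩
  have hzero : P = 0 := by
    refine eq_zero_of_natDegree_lt_card_of_eval_eq_zero' P {y, r₁, r₂, r₃, r₄} ?_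
      (by rw [hcard]; lia)
    intro t ht
    simp only [Finset.mem_insert, Finset.mem_singleton] at ht
    rw [heval]
    rcases ht with rfl | rfl | rfl | rfl | rfl <;> assumption
  have := heval 0
  norm_num [hzero, extremaQuartic] at this

/-- The abscissa of the point at height `y` on the second factor of `∂f10/∂y`. -/
noncomputable def polarX (y : ℝ) : ℝ := -(8 * y ^ 3 - 25 * y + 3 / 2) / (6 * y - 1)

theorem polarX_mul {y : ℝ} (hy : 6 * y - 1 ≠ 0) :
    polarX y * (6 * y - 1) = -(8 * y ^ 3 - 25 * y + 3 / 2) :=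
  div_mul_cancel₀ _ hy

theorem f10xy_polarX {y : ℝ} (hy : 6 * y - 1 ≠ 0) :
    f10xy (polarX y) y = -(8 * y ^ 3 - 25 * y + 3 / 2) := by
  simp only [f10xy]; linear_combination 2 * polarX_mul hy

theorem isCriticalPt_polarX_iff {y : ℝ} (hy : 6 * y - 1 ≠ 0) :
    IsCriticalPt f10 (polarX y, y) ↔ y ^ 2 - 3 * y - 3 / 2 = 0 ∨ extremaQuartic y = 0 := by
  have h := polarX_mul hy
  rw [isCriticalPt_f10_iff, ← mul_eq_zero, and_iff_left (by linear_combination polarX y * h)]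
  have key : (y ^ 2 - 3 * y - 3 / 2) * extremaQuartic y = (6 * y - 1) ^ 2 *
      (3 * polarX y ^ 2 + 2 * (3 * y ^ 2 - y - 15 / 2) * polarX y
      + (2 * y ^ 2 - 2 * y - 9 / 2) * (y ^ 2 + y - 3)) := by
    simp only [extremaQuartic]
    linear_combination (-3 * (polarX y * (6 * y - 1) - (8 * y ^ 3 - 25 * y + 3 / 2)) -
      2 * (3 * y ^ 2 - y - 15 / 2) * (6 * y - 1)) * h
  rw [key, mul_eq_zero, or_iff_right (pow_ne_zero 2 hy)]

theorem isSaddlePt_zero {y : ℝ} (h : (2 * y ^ 2 - 2 * y - 9 / 2) * (y ^ 2 + y - 3) = 0)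
    (h' : 8 * y ^ 3 - 25 * y + 3 / 2 ≠ 0) : IsSaddlePt (0, y) := by
  refine ⟨(isCriticalPt_f10_iff _ _).2 ⟨by linear_combination h, by ring⟩, ?_⟩
  rw [hessDet_f10]
  simp only [f10yy, f10xy]
  have : 0 < (8 * y ^ 3 - 25 * y + 3 / 2) ^ 2 := by positivity
  linarith

theorem isSaddlePt_polarX {y : ℝ} (h : y ^ 2 - 3 * y - 3 / 2 = 0) :
    IsSaddlePt (polarX y, y) := by
  have hy : 6 * y - 1 ≠ 0 := fun h0 => by nlinarith
  refine ⟨(isCriticalPt_polarX_iff hy).2 (Or.inl h), ?_⟩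
  have hx : polarX y = -(4 * y - 3 / 2) := by
    refine mul_right_cancel₀ hy ?_
    linear_combination polarX_mul hy - 8 * y * h
  rw [hessDet_f10, f10xy_polarX hy, hx]
  have h3 : y ^ 3 = 21 / 2 * y + 9 / 2 := by linear_combination (y + 3) * h
  have : 0 < (4 * y - 3 / 2) ^ 2 := by
    have : 4 * y - 3 / 2 ≠ 0 := fun h0 => by nlinarith
    positivity
  have key : f10xx (-(4 * y - 3 / 2)) y * f10yy (-(4 * y - 3 / 2)) y
      - (-(8 * y ^ 3 - 25 * y + 3 / 2)) ^ 2 = -15 * (4 * y - 3 / 2) ^ 2 := by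
    simp only [f10xx, f10yy, h3]
    have h2 : y ^ 2 = 3 * y + 3 / 2 := by linear_combination h
    rw [h2]
    linear_combination (1536 * y + 855) * h
  rw [key]
  linarith

theorem isMinPt_polarX {y m a b : ℝ} (hy : 6 * y - 1 ≠ 0) (h : extremaQuartic y = 0)
    (hm : |8 * y ^ 3 - 25 * y + 3 / 2| < m) (ha : 0 < a) (hxx : a < f10xx (polarX y) y)
    (hb : 0 < b) (hyy : b < f10yy (polarX y) y) (hab : m ^ 2 ≤ a * b) :
    IsMinPt (polarX y, y) := by
  refine ⟨(isCriticalPt_polarX_iff hy).2 (Or.inr h), ha.trans hxx, ?_⟩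
  rw [hessDet_f10, f10xy_polarX hy, neg_sq, ← sq_abs (8 * y ^ 3 - 25 * y + 3 / 2)]
  have h₁ : |8 * y ^ 3 - 25 * y + 3 / 2| ^ 2 < m ^ 2 := by gcongr
  have h₂ : a * b < f10xx (polarX y) y * f10yy (polarX y) y := by gcongr
  linarith

theorem isMaxPt_polarX {y m a b : ℝ} (hy : 6 * y - 1 ≠ 0) (h : extremaQuartic y = 0)
    (hm : |8 * y ^ 3 - 25 * y + 3 / 2| < m) (ha : 0 < a) (hxx : f10xx (polarX y) y < -a)
    (hb : 0 < b) (hyy : f10yy (polarX y) y < -b) (hab : m ^ 2 ≤ a * b) :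
    IsMaxPt (polarX y, y) := by
  refine ⟨(isCriticalPt_polarX_iff hy).2 (Or.inr h), hxx.trans (neg_neg_of_pos ha), ?_⟩
  rw [hessDet_f10, f10xy_polarX hy, neg_sq, ← sq_abs (8 * y ^ 3 - 25 * y + 3 / 2)]
  have h₁ : |8 * y ^ 3 - 25 * y + 3 / 2| ^ 2 < m ^ 2 := by gcongr
  have h₂ : a * b < -f10xx (polarX y) y * -f10yy (polarX y) y := by
    gcongr <;> linarith
  linarith

theorem isMinPt_first {y : ℝ} (h₁ : -1467 / 1000 < y) (h₂ : y < -1466 / 1000)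
    (h : extremaQuartic y = 0) : IsMinPt (polarX y, y) := by
  have hy2 : 2149 / 1000 < y ^ 2 := by nlinarith
  have hy2' : y ^ 2 < 2153 / 1000 := by nlinarith
  have hP : 128 / 10 < 8 * y ^ 3 - 25 * y + 3 / 2 := by nlinarith
  have hP' : 8 * y ^ 3 - 25 * y + 3 / 2 < 13 := by nlinarith
  have hd : 6 * y - 1 < 0 := by linarith
  have hx : 13 / 10 < polarX y := by rw [polarX, lt_div_iff_of_neg hd]; linarith
  refine isMinPt_polarX hd.ne h (m := 13) (a := 8) (b := 40) (abs_lt.2 ⟨by linarith, hP'⟩)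
    (by norm_num) ?_ (by norm_num) ?_ (by norm_num)
  · rw [f10xx]; linarith
  · rw [f10yy]; nlinarith

theorem isMaxPt_first {y : ℝ} (h₁ : 18 / 1000 < y) (h₂ : y < 19 / 1000)
    (h : extremaQuartic y = 0) : IsMaxPt (polarX y, y) := by
  have hy2 : y ^ 2 < 1 / 1000 := by nlinarith
  have hy3 : 0 < y ^ 3 := pow_pos (by linarith) 3
  have hP : 1 < 8 * y ^ 3 - 25 * y + 3 / 2 := by linarith
  have hP' : 8 * y ^ 3 - 25 * y + 3 / 2 < 11 / 10 := by nlinarith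
  have hd : 6 * y - 1 < 0 := by linarith
  have hx : 11 / 10 < polarX y := by rw [polarX, lt_div_iff_of_neg hd]; linarith
  have hx' : polarX y < 13 / 10 := by rw [polarX, div_lt_iff_of_neg hd]; linarith
  refine isMaxPt_polarX hd.ne h (m := 2) (a := 7) (b := 18)
    (abs_lt.2 ⟨by linarith, by linarith⟩) (by norm_num) ?_ (by norm_num) ?_ (by norm_num)
  · rw [f10xx]; linarith
  · rw [f10yy]; nlinarith

theorem isMinPt_second {y : ℝ} (h₁ : 937 / 1000 < y) (h₂ : y < 938 / 1000)
    (h : extremaQuartic y = 0) : IsMinPt (polarX y, y) := by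
  have hy2 : 8779 / 10000 < y ^ 2 := by nlinarith
  have hy2' : y ^ 2 < 8799 / 10000 := by nlinarith
  have hP : -154 / 10 < 8 * y ^ 3 - 25 * y + 3 / 2 := by nlinarith
  have hP' : 8 * y ^ 3 - 25 * y + 3 / 2 < -153 / 10 := by nlinarith
  have hd : 0 < 6 * y - 1 := by linarith
  have hx : 33 / 10 < polarX y := by rw [polarX, lt_div_iff₀ hd]; linarith
  refine isMinPt_polarX hd.ne' h (m := 16) (a := 8) (b := 50)
    (abs_lt.2 ⟨by linarith, by linarith⟩) (by norm_num) ?_ (by norm_num) ?_ (by norm_num)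
  · rw [f10xx]; linarith
  · rw [f10yy]; nlinarith

theorem isMaxPt_second {y : ℝ} (h₁ : 2510 / 1000 < y) (h₂ : y < 2511 / 1000)
    (h : extremaQuartic y = 0) : IsMaxPt (polarX y, y) := by
  have hy2 : 6300 / 1000 < y ^ 2 := by nlinarith
  have hy2' : y ^ 2 < 6306 / 1000 := by nlinarith
  have hP : 652 / 10 < 8 * y ^ 3 - 25 * y + 3 / 2 := by nlinarith
  have hP' : 8 * y ^ 3 - 25 * y + 3 / 2 < 6542 / 100 := by nlinarith
  have hd : 0 < 6 * y - 1 := by linarith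
  have hx : -466 / 100 < polarX y := by rw [polarX, lt_div_iff₀ hd]; linarith
  have hx' : polarX y < -463 / 100 := by rw [polarX, div_lt_iff₀ hd]; linarith
  refine isMaxPt_polarX hd.ne' h (m := 6542 / 100) (a := 99 / 10) (b := 450)
    (abs_lt.2 ⟨by linarith, by linarith⟩) (by norm_num) ?_ (by norm_num) ?_ (by norm_num)
  · rw [f10xx]; linarith
  · rw [f10yy]; nlinarith

theorem isCriticalPt_f10_cases {x y : ℝ} (hc : IsCriticalPt f10 (x, y)) :
    (x = 0 ∧ (y ^ 2 - y - 9 / 4 = 0 ∨ y ^ 2 + y - 3 = 0)) ∨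
      (x = polarX y ∧ (y ^ 2 - 3 * y - 3 / 2 = 0 ∨ extremaQuartic y = 0)) := by
  obtain ⟨h₁, h₂⟩ := (isCriticalPt_f10_iff x y).1 hc
  rcases mul_eq_zero.1 h₂ with rfl | h₂
  · refine Or.inl ⟨rfl, mul_eq_zero.1 ?_⟩
    linear_combination h₁ / 2
  · have hy : 6 * y - 1 ≠ 0 := by
      intro h0
      obtain rfl : y = 1 / 6 := by linarith
      norm_num at h₂
    obtain rfl : x = polarX y := by
      refine mul_right_cancel₀ hy ?_
      linear_combination h₂ - polarX_mul hy
    exact Or.inr ⟨rfl, (isCriticalPt_polarX_iff hy).1 hc⟩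

theorem exists_quadratic_roots (b c : ℝ) (h : 0 ≤ b ^ 2 - 4 * c) :
    ∃ r₁ r₂ : ℝ, r₁ = (-b - √(b ^ 2 - 4 * c)) / 2 ∧ r₂ = (-b + √(b ^ 2 - 4 * c)) / 2 ∧
      ∀ y, y ^ 2 + b * y + c = 0 ↔ y = r₁ ∨ y = r₂ := by
  refine ⟨_, _, rfl, rfl, fun y => ?_⟩
  rw [← sub_eq_zero (a := y), ← sub_eq_zero (a := y), ← mul_eq_zero]
  have : y ^ 2 + b * y + c = (y - (-b - √(b ^ 2 - 4 * c)) / 2) *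
      (y - (-b + √(b ^ 2 - 4 * c)) / 2) := by
    linear_combination Real.sq_sqrt h / 4
  rw [this]

theorem ncard_setOf_and_eq_card {ι α : Type*} {g : ι → α} (hg : Function.Injective g)
    {C Q : α → Prop} (hC : ∀ p, C p ↔ ∃ i, g i = p) (s : Finset ι)
    (hs : ∀ i, Q (g i) ↔ i ∈ s) : {p | C p ∧ Q p}.ncard = s.card := by
  have : {p | C p ∧ Q p} = g '' s := by
    ext p
    simp only [Set.mem_ofPred_eq, hC, Set.mem_image, SetLike.mem_coe]
    constructor
    · rintro ⟨⟨i, rfl⟩, h⟩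
      exact ⟨i, (hs i).1 h, rfl⟩
    · rintro ⟨i, h, rfl⟩
      exact ⟨⟨i, rfl⟩, (hs i).2 h⟩
  rw [this, Set.ncard_image_of_injective _ hg, Set.ncard_coe_finset]

/-- An enumeration of the critical points of `f10` by increasing height. -/
theorem exists_enumeration_f10 : ∃ g : Fin 10 → ℝ × ℝ, Function.Injective g ∧
    (∀ p, IsCriticalPt f10 p ↔ ∃ i, g i = p) ∧
    (∀ i ∈ ({1, 5} : Finset (Fin 10)), IsMinPt (g i)) ∧
    (∀ i ∈ ({4, 8} : Finset (Fin 10)), IsMaxPt (g i)) ∧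
    (∀ i ∈ ({0, 2, 3, 6, 7, 9} : Finset (Fin 10)), IsSaddlePt (g i)) := by
  obtain ⟨a₁, a₂, ha₁, ha₂, ha⟩ := exists_quadratic_roots (-1) (-9 / 4) (by norm_num)
  obtain ⟨b₁, b₂, hb₁, hb₂, hb⟩ := exists_quadratic_roots 1 (-3) (by norm_num)
  obtain ⟨c₁, c₂, hc₁, hc₂, hc⟩ := exists_quadratic_roots (-3) (-3 / 2) (by norm_num)
  norm_num at ha₁ ha₂ hb₁ hb₂ hc₁ hc₂
  have s10 : 3 < √10 := Real.lt_sqrt_of_sq_lt (by norm_num)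
  have s10' : √10 < 3.5 := (Real.sqrt_lt' (by norm_num)).2 (by norm_num)
  have s13 : 3.5 < √13 := Real.lt_sqrt_of_sq_lt (by norm_num)
  have s13' : √13 < 4 := (Real.sqrt_lt' (by norm_num)).2 (by norm_num)
  have s15 : 3.5 < √15 := Real.lt_sqrt_of_sq_lt (by norm_num)
  have s15' : √15 < 4 := (Real.sqrt_lt' (by norm_num)).2 (by norm_num)
  norm_num at s10' s13 s15
  obtain ⟨r₁, l₁, u₁, hr₁⟩ := exists_extremaQuartic_eq_zero (a := -1467 / 1000)
    (b := -1466 / 1000) (by norm_num) (by norm_num [extremaQuartic])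
  obtain ⟨r₂, l₂, u₂, hr₂⟩ := exists_extremaQuartic_eq_zero (a := 18 / 1000)
    (b := 19 / 1000) (by norm_num) (by norm_num [extremaQuartic])
  obtain ⟨r₃, l₃, u₃, hr₃⟩ := exists_extremaQuartic_eq_zero (a := 937 / 1000)
    (b := 938 / 1000) (by norm_num) (by norm_num [extremaQuartic])
  obtain ⟨r₄, l₄, u₄, hr₄⟩ := exists_extremaQuartic_eq_zero (a := 2510 / 1000)
    (b := 2511 / 1000) (by norm_num) (by norm_num [extremaQuartic])
  have saddleA {y : ℝ} (h : y = a₁ ∨ y = a₂) : IsSaddlePt (0, y) := by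
    have h2 := (ha y).2 h
    refine isSaddlePt_zero (by linear_combination 2 * (y ^ 2 + y - 3) * h2) ?_
    have : 8 * y ^ 3 - 25 * y + 3 / 2 = y + 39 / 2 := by linear_combination 8 * (y + 1) * h2
    rcases h with rfl | rfl <;> linarith
  have saddleB {y : ℝ} (h : y = b₁ ∨ y = b₂) : IsSaddlePt (0, y) := by
    have h2 := (hb y).2 h
    refine isSaddlePt_zero (by linear_combination (2 * y ^ 2 - 2 * y - 9 / 2) * h2) ?_
    have : 8 * y ^ 3 - 25 * y + 3 / 2 = 7 * y - 45 / 2 := by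
      linear_combination 8 * (y - 1) * h2
    rcases h with rfl | rfl <;> linarith
  have saddleC {y : ℝ} (h : y = c₁ ∨ y = c₂) : IsSaddlePt (polarX y, y) :=
    isSaddlePt_polarX (by linear_combination (hc y).2 h)
  let g : Fin 10 → ℝ × ℝ := ![(0, b₁), (polarX r₁, r₁), (0, a₁), (polarX c₁, c₁),
    (polarX r₂, r₂), (polarX r₃, r₃), (0, b₂), (0, a₂), (polarX r₄, r₄), (polarX c₂, c₂)]
  have hmono : StrictMono (Prod.snd ∘ g) := by
    rw [Fin.strictMono_iff_lt_succ]
    intro i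
    fin_cases i <;> simp [g] <;> linarith
  have hmin : ∀ i ∈ ({1, 5} : Finset (Fin 10)), IsMinPt (g i) := by
    simp only [Finset.forall_mem_insert, Finset.mem_singleton, forall_eq]
    exact ⟨isMinPt_first l₁ u₁ hr₁, isMinPt_second l₃ u₃ hr₃⟩
  have hmax : ∀ i ∈ ({4, 8} : Finset (Fin 10)), IsMaxPt (g i) := by
    simp only [Finset.forall_mem_insert, Finset.mem_singleton, forall_eq]
    exact ⟨isMaxPt_first l₂ u₂ hr₂, isMaxPt_second l₄ u₄ hr₄⟩
  have hsaddle : ∀ i ∈ ({0, 2, 3, 6, 7, 9} : Finset (Fin 10)), IsSaddlePt (g i) := by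
    simp only [Finset.forall_mem_insert, Finset.mem_singleton, forall_eq]
    exact ⟨saddleB (.inl rfl), saddleA (.inl rfl), saddleC (.inl rfl), saddleB (.inr rfl),
      saddleA (.inr rfl), saddleC (.inr rfl)⟩
  refine ⟨g, hmono.injective.of_comp, fun p => ⟨fun h => ?_, ?_⟩, hmin, hmax, hsaddle⟩
  · obtain ⟨x, y⟩ := p
    rcases isCriticalPt_f10_cases h with ⟨rfl, h | h⟩ | ⟨rfl, h | h⟩
    · rcases (ha y).1 (by linear_combination h) with rfl | rfl
      exacts [⟨2, rfl⟩, ⟨7, rfl⟩]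
    · rcases (hb y).1 (by linear_combination h) with rfl | rfl
      exacts [⟨0, rfl⟩, ⟨6, rfl⟩]
    · rcases (hc y).1 (by linear_combination h) with rfl | rfl
      exacts [⟨3, rfl⟩, ⟨9, rfl⟩]
    · rcases eq_of_extremaQuartic_eq_zero (by linarith) (by linarith) (by linarith)
        hr₁ hr₂ hr₃ hr₄ h with rfl | rfl | rfl | rfl
      exacts [⟨1, rfl⟩, ⟨4, rfl⟩, ⟨5, rfl⟩, ⟨8, rfl⟩]
  · rintro ⟨i, rfl⟩
    have hi : i ∈ ({1, 5} : Finset (Fin 10)) ∨ i ∈ ({4, 8} : Finset (Fin 10)) ∨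
        i ∈ ({0, 2, 3, 6, 7, 9} : Finset (Fin 10)) := by decide +revert
    rcases hi with hi | hi | hi
    exacts [(hmin i hi).1, (hmax i hi).1, (hsaddle i hi).1]

/-- The polynomial `f10` has only nondegenerate critical points; it has exactly
10 critical points, of which exactly 2 are local minima, exactly 6 are
saddles, and exactly 2 are local maxima. -/
theorem morse_data_f10 :
    (∀ p : ℝ × ℝ, IsCriticalPt f10 p → hessDet f10 p ≠ 0) ∧
    {p : ℝ × ℝ | IsCriticalPt f10 p}.Finite ∧
    {p : ℝ × ℝ | IsCriticalPt f10 p}.ncard = 10 ∧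
    {p : ℝ × ℝ | IsCriticalPt f10 p ∧ IsLocMin f10 p}.ncard = 2 ∧
    {p : ℝ × ℝ | IsSaddle f10 p}.ncard = 6 ∧
    {p : ℝ × ℝ | IsCriticalPt f10 p ∧ IsLocMax f10 p}.ncard = 2 := by
  obtain ⟨g, hg, hC, hmin, hmax, hsaddle⟩ := exists_enumeration_f10
  have hi (i : Fin 10) : i ∈ ({1, 5} : Finset (Fin 10)) ∨ i ∈ ({4, 8} : Finset (Fin 10)) ∨
      i ∈ ({0, 2, 3, 6, 7, 9} : Finset (Fin 10)) := by decide +revert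
  have hdisj (i : Fin 10) : (i ∈ ({1, 5} : Finset (Fin 10)) →
        i ∉ ({4, 8} : Finset (Fin 10)) ∧ i ∉ ({0, 2, 3, 6, 7, 9} : Finset (Fin 10))) ∧
      (i ∈ ({4, 8} : Finset (Fin 10)) → i ∉ ({0, 2, 3, 6, 7, 9} : Finset (Fin 10))) := by
    decide +revert
  have key (i : Fin 10) : hessDet f10 (g i) ≠ 0 ∧
      (IsLocMin f10 (g i) ↔ i ∈ ({1, 5} : Finset (Fin 10))) ∧
      (IsLocMax f10 (g i) ↔ i ∈ ({4, 8} : Finset (Fin 10))) ∧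
      ((¬ IsLocMin f10 (g i) ∧ ¬ IsLocMax f10 (g i)) ↔
        i ∈ ({0, 2, 3, 6, 7, 9} : Finset (Fin 10))) := by
    have hd := hdisj i
    rcases hi i with h | h | h
    · have := (hmin i h).types
      tauto
    · have := (hmax i h).types
      tauto
    · have := (hsaddle i h).types
      tauto
  have hset : {p : ℝ × ℝ | IsCriticalPt f10 p} = Set.range g := Set.ext hC
  refine ⟨fun p hp => ?_, ?_, ?_, ?_, ?_, ?_⟩
  · obtain ⟨i, rfl⟩ := (hC p).1 hp
    exact (key i).1
  · rw [hset]
    exact Set.finite_range g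
  · rw [hset, ← Set.image_univ, Set.ncard_image_of_injective _ hg, Set.ncard_univ]
    simp
  · exact ncard_setOf_and_eq_card hg hC {1, 5} fun i => (key i).2.1
  · exact ncard_setOf_and_eq_card hg hC {0, 2, 3, 6, 7, 9} fun i => (key i).2.2.2
  · exact ncard_setOf_and_eq_card hg hC {4, 8} fun i => (key i).2.2.1
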